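/- Let K ⊆ V ⊗ k be a strictly characteristic subspace with normalized generator e of l_K and structure constants a_i = ⟨e, φ^{σ₀+i}(e)⟩ (1 ≤ i ≤ σ₀ − 1). Then {ζ ∈ k : there exists g ∈ O_K(V) with (g ⊗ k)(e) = ζ·e} = {ζ ∈ k : ζ^{p^m+1} = 1}, where m is the largest positive divisor of σ₀ such that σ₀/m is odd and a_i = 0 for every 1 ≤ i ≤ σ₀ − 1 not divisible by 2m, with m = 0 if no such divisor exists. -/

import Mathlib

open TensorProduct

noncomputable section

variable (p : ℕ) [Fact p.Prime] (k : Type) [Field k] [CharP k p] [Algebra (ZMod p) k]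

/-- The `p`-power (Frobenius) map on `k` as a `ZMod p`-linear map. -/
def frobLin : k →ₗ[ZMod p] k where
  toFun a := a ^ p
  map_add' a b := add_pow_char a b p
  map_smul' c a := by
    simp only [RingHom.id_apply]
    rw [Algebra.smul_def, Algebra.smul_def, mul_pow, ← map_pow, ZMod.pow_card]

variable (V : Type) [AddCommGroup V] [Module (ZMod p) V]

/-- The Frobenius-semilinear endomorphism `φ = id_V ⊗ (λ ↦ λ^p)` of `k ⊗[𝔽_p] V`. -/
def frobT : (k ⊗[ZMod p] V) →ₛₗ[frobenius k p] (k ⊗[ZMod p] V) where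
  toFun := LinearMap.rTensor V (frobLin p k)
  map_add' := map_add _
  map_smul' c x := by
    induction x using TensorProduct.induction_on with
    | zero => simp
    | tmul a v =>
        simp [smul_tmul', frobLin, frobenius_def, mul_pow]
    | add x y hx hy => simp_all [smul_add]

variable [IsAlgClosed k]

instance : RingHomSurjective (frobenius k p) := ⟨surjective_frobenius k p⟩

/-- The base change to `k` of the bilinear form `B`. -/
abbrev bcForm (B : LinearMap.BilinForm (ZMod p) V) :
    LinearMap.BilinForm k (k ⊗[ZMod p] V) :=
  LinearMap.BilinForm.baseChange k B

variable (σ₀ : ℕ) (B : LinearMap.BilinForm (ZMod p) V)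

/-- `K ⊆ V ⊗ k` is a characteristic subspace: totally isotropic of dimension `σ₀`,
and `K + φ(K)` has dimension `σ₀ + 1`. -/
def IsCharacteristicSub (K : Submodule k (k ⊗[ZMod p] V)) : Prop :=
  (∀ x ∈ K, ∀ y ∈ K, bcForm p k V B x y = 0) ∧
  Module.finrank k K = σ₀ ∧
  Module.finrank k ↥(K ⊔ Submodule.map (frobT p k V) K) = σ₀ + 1

/-- `K` is strictly characteristic if moreover `∑ᵢ φ^i(K) = V ⊗ k`. -/
def IsStrictlyCharacteristicSub (K : Submodule k (k ⊗[ZMod p] V)) : Prop :=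
  IsCharacteristicSub p k V σ₀ B K ∧
  (⨆ i : ℕ, (Submodule.map (frobT p k V))^[i] K) = ⊤

/-- `l_K = K ∩ φ(K) ∩ ⋯ ∩ φ^{σ₀ − 1}(K)`. -/
def lK (K : Submodule k (k ⊗[ZMod p] V)) : Submodule k (k ⊗[ZMod p] V) :=
  ⨅ i : Fin σ₀, (Submodule.map (frobT p k V))^[(i : ℕ)] K

/-- The group `O_K(V)` of isometries of `(V, B)` such that `g ⊗ k` maps `K` to itself. -/
def OK (K : Submodule k (k ⊗[ZMod p] V)) : Subgroup (V ≃ₗ[ZMod p] V) where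
  carrier := {g : V ≃ₗ[ZMod p] V | (∀ x y : V, B (g x) (g y) = B x y) ∧
    Submodule.map (LinearMap.baseChange k (g : V →ₗ[ZMod p] V)) K = K}
  one_mem' := by
    refine ⟨fun x y => rfl, ?_⟩
    rw [LinearEquiv.coe_toLinearMap_one, LinearMap.baseChange_id, Submodule.map_id]
  mul_mem' := by
    rintro g h ⟨hg1, hg2⟩ ⟨hh1, hh2⟩
    refine ⟨fun x y => (hg1 (h x) (h y)).trans (hh1 x y), ?_⟩
    have hco : ((g * h : V ≃ₗ[ZMod p] V) : V →ₗ[ZMod p] V)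
        = (g : V →ₗ[ZMod p] V).comp (h : V →ₗ[ZMod p] V) := rfl
    rw [hco, LinearMap.baseChange_comp, Submodule.map_comp, hh2, hg2]
  inv_mem' := by
    rintro g ⟨hg1, hg2⟩
    constructor
    · intro x y
      have h1 : g (g⁻¹ x) = x := g.apply_symm_apply x
      have h2 : g (g⁻¹ y) = y := g.apply_symm_apply y
      have := hg1 (g⁻¹ x) (g⁻¹ y)
      rw [h1, h2] at this
      exact this.symm
    · conv_lhs => rw [← hg2]
      rw [← Submodule.map_comp, ← LinearMap.baseChange_comp]
      have hco : ((g⁻¹ : V ≃ₗ[ZMod p] V) : V →ₗ[ZMod p] V).comp (g : V →ₗ[ZMod p] V)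
          = LinearMap.id := by
        ext x
        exact g.symm_apply_apply x
      rw [hco, LinearMap.baseChange_id, Submodule.map_id]

end


section helpers
set_option linter.unusedSectionVars false
variable (p : ℕ) [Fact p.Prime] (k : Type) [Field k] [CharP k p] [Algebra (ZMod p) k]
variable (V : Type) [AddCommGroup V] [Module (ZMod p) V]

theorem frobT_tmul (a : k) (v : V) : frobT p k V (a ⊗ₜ[ZMod p] v) = (a ^ p) ⊗ₜ[ZMod p] v := rfl

theorem bc_frob (B : LinearMap.BilinForm (ZMod p) V) (x y : k ⊗[ZMod p] V) :
    bcForm p k V B (frobT p k V x) (frobT p k V y) = (bcForm p k V B x y) ^ p := by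
  induction x using TensorProduct.induction_on with
  | zero => simp [(Fact.out : p.Prime).ne_zero]
  | add x y hx hy => simp [hx, hy, add_pow_char]
  | tmul a v =>
    induction y using TensorProduct.induction_on with
    | zero => simp [(Fact.out : p.Prime).ne_zero]
    | add x y hx hy => simp only [map_add, hx, hy, add_pow_char]
    | tmul b w =>
      simp only [frobT_tmul, LinearMap.BilinForm.baseChange_tmul, Algebra.smul_def, mul_pow]
      rw [← map_pow, ZMod.pow_card]

theorem bc_frob_iter (B : LinearMap.BilinForm (ZMod p) V) (n : ℕ) (x y : k ⊗[ZMod p] V) :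
    bcForm p k V B ((frobT p k V)^[n] x) ((frobT p k V)^[n] y) = (bcForm p k V B x y) ^ (p ^ n) := by
  induction n with
  | zero => simp
  | succ n ih => rw [Function.iterate_succ_apply', Function.iterate_succ_apply', bc_frob, ih, pow_succ, pow_mul]

theorem frob_iter_smul (n : ℕ) (c : k) (x : k ⊗[ZMod p] V) :
    (frobT p k V)^[n] (c • x) = c ^ (p ^ n) • (frobT p k V)^[n] x := by
  induction n with
  | zero => simp
  | succ n ih =>
    rw [Function.iterate_succ_apply', ih, Function.iterate_succ_apply', map_smulₛₗ, frobenius_def,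
      pow_succ, pow_mul]

theorem frobT_baseChange (g : V →ₗ[ZMod p] V) (x : k ⊗[ZMod p] V) :
    LinearMap.baseChange k g (frobT p k V x) = frobT p k V (LinearMap.baseChange k g x) := by
  induction x using TensorProduct.induction_on with
  | zero => simp
  | add x y hx hy => simp [hx, hy]
  | tmul a v => simp [frobT_tmul]

theorem frobT_iter_baseChange (g : V →ₗ[ZMod p] V) (n : ℕ) (x : k ⊗[ZMod p] V) :
    LinearMap.baseChange k g ((frobT p k V)^[n] x) = (frobT p k V)^[n] (LinearMap.baseChange k g x) := by
  induction n with
  | zero => simp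
  | succ n ih => rw [Function.iterate_succ_apply', Function.iterate_succ_apply', frobT_baseChange, ih]

theorem bc_isom (B : LinearMap.BilinForm (ZMod p) V) (g : V →ₗ[ZMod p] V)
    (hg : ∀ x y, B (g x) (g y) = B x y) (x y : k ⊗[ZMod p] V) :
    bcForm p k V B (LinearMap.baseChange k g x) (LinearMap.baseChange k g y) = bcForm p k V B x y := by
  induction x using TensorProduct.induction_on with
  | zero => simp
  | add x y hx hy => simp [hx, hy]
  | tmul a v =>
    induction y using TensorProduct.induction_on with
    | zero => simp
    | add x y hx hy => simp only [map_add, hx, hy]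
    | tmul b w => simp [LinearMap.BilinForm.baseChange_tmul, hg]

theorem bc_symm (B : LinearMap.BilinForm (ZMod p) V) (hB : B.IsSymm) (x y : k ⊗[ZMod p] V) :
    bcForm p k V B x y = bcForm p k V B y x := by
  induction x using TensorProduct.induction_on with
  | zero => simp
  | add x y hx hy => simp [hx, hy]
  | tmul a v =>
    induction y using TensorProduct.induction_on with
    | zero => simp
    | add x y hx hy => simp only [map_add, hx, hy, LinearMap.add_apply]
    | tmul b w =>
      simp only [LinearMap.BilinForm.baseChange_tmul]
      rw [mul_comm, hB.eq w v]

theorem mem_prime_of_pow (x : k) (hx : x ^ p = x) : ∃ c : ZMod p, algebraMap (ZMod p) k c = x := by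
  classical
  by_contra hcon
  push Not at hcon
  have hp : 1 < p := (Fact.out : p.Prime).one_lt
  have hne : (Polynomial.X ^ p - Polynomial.X : Polynomial k) ≠ 0 := FiniteField.X_pow_card_sub_X_ne_zero k hp
  have hdeg := FiniteField.X_pow_card_sub_X_natDegree_eq k hp
  have hcard := (Polynomial.card_roots' (Polynomial.X ^ p - Polynomial.X : Polynomial k))
  rw [hdeg] at hcard
  have hinj : Function.Injective (algebraMap (ZMod p) k) := (algebraMap (ZMod p) k).injective
  have hsub : insert x (Finset.univ.image (algebraMap (ZMod p) k)) ⊆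
      (Polynomial.X ^ p - Polynomial.X : Polynomial k).roots.toFinset := by
    intro y hy
    rw [Multiset.mem_toFinset, Polynomial.mem_roots hne]
    rw [Finset.mem_insert, Finset.mem_image] at hy
    rcases hy with rfl | ⟨c, _, rfl⟩
    · simp [hx]
    · simp [← map_pow, ZMod.pow_card]
  have h1 := Finset.card_le_card hsub
  rw [Finset.card_insert_of_notMem (by simpa using hcon), Finset.card_image_of_injective _ hinj,
    Finset.card_univ, ZMod.card] at h1
  have h2 := Multiset.toFinset_card_le (Polynomial.X ^ p - Polynomial.X : Polynomial k).roots
  omega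

theorem frobT_fixed [Module.Finite (ZMod p) V] (x : k ⊗[ZMod p] V) (hx : frobT p k V x = x) :
    ∃ v : V, (1 : k) ⊗ₜ[ZMod p] v = x := by
  let b := Module.finBasis (ZMod p) V
  let b' := Algebra.TensorProduct.basis k b
  have hb : ∀ i, b' i = 1 ⊗ₜ b i := fun i => by simp [b']
  have hfb : ∀ i, frobT p k V (b' i) = b' i := fun i => by rw [hb, frobT_tmul, one_pow]
  have hsum := b'.sum_repr x
  have h2 : ∑ i, (b'.repr x i) ^ p • b' i = ∑ i, b'.repr x i • b' i := by
    conv_rhs => rw [hsum, ← hx, ← hsum]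
    simp only [map_sum, map_smulₛₗ, frobenius_def, hfb]
  have h3 : ∀ i, (b'.repr x i) ^ p = b'.repr x i := by
    intro i
    have := congrArg (fun z => b'.repr z i) h2
    simpa [Finsupp.single_apply] using this
  choose c hc using fun i => mem_prime_of_pow p k _ (h3 i)
  refine ⟨∑ i, c i • b i, ?_⟩
  rw [tmul_sum, ← hsum]
  refine Finset.sum_congr rfl fun i _ => ?_
  rw [hb, ← hc, tmul_smul, algebraMap_smul]

theorem mem_iter_map [IsAlgClosed k] (K : Submodule k (k ⊗[ZMod p] V)) (n : ℕ) (x : k ⊗[ZMod p] V) :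
    x ∈ (Submodule.map (frobT p k V))^[n] K ↔ ∃ y ∈ K, (frobT p k V)^[n] y = x := by
  induction n generalizing x with
  | zero => simp
  | succ n ih =>
    rw [Function.iterate_succ_apply', Submodule.mem_map]
    constructor
    · rintro ⟨z, hz, rfl⟩
      obtain ⟨y, hy, rfl⟩ := (ih z).1 hz
      exact ⟨y, hy, Function.iterate_succ_apply' _ _ _⟩
    · rintro ⟨y, hy, rfl⟩
      exact ⟨_, (ih _).2 ⟨y, hy, rfl⟩, (Function.iterate_succ_apply' _ _ _).symm⟩

theorem frobT_inj : Function.Injective (frobT p k V) := by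
  have : Function.Injective (LinearMap.rTensor V (frobLin p k)) :=
    Module.Flat.rTensor_preserves_injective_linearMap _ (frobenius_inj k p)
  exact this

theorem seq_core {W : Type} [AddCommGroup W] [Module k W] (b : LinearMap.BilinForm k W)
    (s : ℕ) (f : ℕ → W) (hs : ∀ x y, b x y = b y x)
    (h0 : ∀ i j, i ≤ j → j < i + s → b (f i) (f j) = 0)
    (h1 : ∀ i, b (f i) (f (i + s)) = 1) :
    ∀ c : Fin (2 * s) → k, (∀ t, t < 2 * s → b (f t) (∑ i, c i • f i) = 0) → ∀ i, c i = 0 := by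
  intro c hc
  set c' : ℕ → k := fun n => if h : n < 2 * s then c ⟨n, h⟩ else 0 with hc'
  have hcc : ∀ i : Fin (2 * s), c i = c' i := fun i => by simp [hc']
  have hsum : ∑ n ∈ Finset.range (2 * s), c' n • f n = ∑ i, c i • f i := by
    rw [Finset.sum_range]
    exact Finset.sum_congr rfl fun i _ => by rw [hcc]
  have h0' : ∀ i j, i < j + s → j < i + s → b (f i) (f j) = 0 := by
    intro i j h h'
    rcases le_total i j with hh | hh
    · exact h0 i j hh h'
    · rw [hs]; exact h0 j i hh h
  have key : ∀ n t, n < 2 * s → t < 2 * s → b (f t) (f n) = 1 →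
      (∀ i, i < 2 * s → i ≠ n → c' i = 0 ∨ b (f t) (f i) = 0) → c' n = 0 := by
    intro n t hn ht hb hz
    have h := hc t ht
    rw [← hsum, map_sum, Finset.sum_eq_single n] at h
    · simpa [hb] using h
    · intro i hi hin
      rcases hz i (Finset.mem_range.1 hi) hin with h | h <;> simp [h]
    · intro h; exact absurd (Finset.mem_range.2 hn) h
  have A : ∀ t, t < s → c' (2 * s - 1 - t) = 0 := by
    intro t
    induction t using Nat.strong_induction_on with
    | _ t ih =>
      intro ht
      refine key _ (s - 1 - t) (by omega) (by omega) ?_ ?_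
      · have := h1 (s - 1 - t)
        rwa [show s - 1 - t + s = 2 * s - 1 - t by omega] at this
      · intro i hi hin
        by_cases hlt : i < 2 * s - 1 - t
        · right; exact h0' _ _ (by omega) (by omega)
        · left
          have := ih (2 * s - 1 - i) (by omega) (by omega)
          rwa [show 2 * s - 1 - (2 * s - 1 - i) = i by omega] at this
  have A2 : ∀ n, n < s → c' n = 0 := by
    intro n
    induction n using Nat.strong_induction_on with
    | _ n ih =>
      intro hn
      refine key _ (n + s) (by omega) (by omega) ?_ ?_
      · rw [hs]; exact h1 n
      · intro i hi hin
        by_cases hlt : i < n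
        · left; exact ih i hlt (by omega)
        · right; exact h0' _ _ (by omega) (by omega)
  intro i
  rw [hcc]
  by_cases hi : (i : ℕ) < s
  · exact A2 _ hi
  · have := A (2 * s - 1 - i) (by omega)
    rwa [show 2 * s - 1 - (2 * s - 1 - (i : ℕ)) = i by omega] at this

theorem seq_li {W : Type} [AddCommGroup W] [Module k W] (b : LinearMap.BilinForm k W)
    (s : ℕ) (f : ℕ → W) (hs : ∀ x y, b x y = b y x)
    (h0 : ∀ i j, i ≤ j → j < i + s → b (f i) (f j) = 0)
    (h1 : ∀ i, b (f i) (f (i + s)) = 1) :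
    LinearIndependent k (fun i : Fin (2 * s) => f i) := by
  rw [Fintype.linearIndependent_iff]
  intro c hc
  exact seq_core k b s f hs h0 h1 c (fun t _ => by rw [hc, map_zero])

theorem seq_nondeg {W : Type} [AddCommGroup W] [Module k W] (b : LinearMap.BilinForm k W)
    (s : ℕ) (hs1 : 1 ≤ s) (hdim : Module.finrank k W = 2 * s) (f : ℕ → W) (hs : ∀ x y, b x y = b y x)
    (h0 : ∀ i j, i ≤ j → j < i + s → b (f i) (f j) = 0)
    (h1 : ∀ i, b (f i) (f (i + s)) = 1) (x : W) (hx : ∀ t, t < 2 * s → b (f t) x = 0) : x = 0 := by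
  have : Nonempty (Fin (2 * s)) := ⟨⟨0, by omega⟩⟩
  let bs := basisOfLinearIndependentOfCardEqFinrank (seq_li k b s f hs h0 h1) (by rw [hdim, Fintype.card_fin])
  have hbs : ∀ i, bs i = f i := fun i => by simp [bs]
  have hr : ∑ i, bs.repr x i • f i = x := by
    conv_rhs => rw [← bs.sum_repr x]
    simp only [hbs]
  have h := seq_core k b s f hs h0 h1 (bs.repr x) (fun t ht => by rw [hr]; exact hx t ht)
  rw [← hr]
  simp [h]

theorem pow_p_inj (n : ℕ) (x : k) (h : x ^ p ^ n = 1) : x = 1 := by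
  have := iterateFrobenius_inj k p n
  apply this
  simp [iterateFrobenius_def, h]

theorem per_pow (z : k) (d : ℕ) (h : z ^ p ^ d = z) (a t : ℕ) : z ^ p ^ (a + d * t) = z ^ p ^ a := by
  induction t with
  | zero => simp
  | succ t ih =>
    rw [show a + d * (t + 1) = d + (a + d * t) by ring, pow_add p d, pow_mul, h, ih]

/-- number theoretic part -/
theorem root_iff (hodd : Odd p) (s : ℕ) (hs : 1 ≤ s) (S : Set ℕ) (m : ℕ)
    (hm : m = sSup {m' : ℕ | 0 < m' ∧ m' ∣ s ∧ Odd (s / m') ∧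
      ∀ i : ℕ, 1 ≤ i → i ≤ s - 1 → ¬ (2 * m' ∣ i) → i ∉ S}) (z : k) :
    (z ^ (p ^ s + 1) = 1 ∧ ∀ i, 1 ≤ i → i ≤ s - 1 → i ∈ S → z ^ (p ^ (s + i) + 1) = 1)
      ↔ z ^ (p ^ m + 1) = 1 := by
  set M := {m' : ℕ | 0 < m' ∧ m' ∣ s ∧ Odd (s / m') ∧
      ∀ i : ℕ, 1 ≤ i → i ≤ s - 1 → ¬ (2 * m' ∣ i) → i ∉ S} with hM
  have hbdd : BddAbove M := ⟨s, fun x hx => Nat.le_of_dvd (by omega) hx.2.1⟩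
  have hsq : z ^ 2 = 1 → ∀ n, z ^ (p ^ n + 1) = 1 := by
    intro h n
    obtain ⟨t, ht⟩ := (hodd.pow (n := n)).add_one
    rw [ht, ← two_mul, pow_mul, h, one_pow]
  have hdec : ∀ n ∈ M, ∃ t, s = n + 2 * n * t := by
    rintro n ⟨h0, ⟨q, hq⟩, h2, -⟩
    rw [hq, Nat.mul_div_cancel_left _ h0] at h2
    obtain ⟨t, ht⟩ := h2
    exact ⟨t, by rw [hq, ht]; ring⟩
  constructor
  · rintro ⟨h1, h2⟩
    have hz : z ≠ 0 := by
      rintro rfl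
      simp at h1
    have hfix : ∀ i, z ^ (p ^ (s + i) + 1) = 1 → z ^ p ^ i = z := by
      intro i hi
      have : (z ^ p ^ i) ^ p ^ s = z ^ p ^ s := by
        rw [← pow_mul, ← pow_add, add_comm i s]
        apply mul_right_cancel₀ hz
        rw [← pow_succ, ← pow_succ, hi, h1]
      apply iterateFrobenius_inj k p s
      simpa [iterateFrobenius_def] using this
    have hper : ∀ i, Function.IsPeriodicPt (frobenius k p) i z ↔ z ^ p ^ i = z := by
      intro i
      rw [Function.IsPeriodicPt, Function.IsFixedPt, ← coe_iterateFrobenius, iterateFrobenius_def]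
    set d := Function.minimalPeriod (frobenius k p) z with hd
    have hdvd : ∀ i, d ∣ i ↔ z ^ p ^ i = z := by
      intro i
      rw [← hper, Function.isPeriodicPt_iff_minimalPeriod_dvd]
    have hd2s : d ∣ 2 * s := by
      rw [hdvd, two_mul, pow_add, pow_mul]
      have e1 : z ^ p ^ s = z⁻¹ := eq_inv_of_mul_eq_one_left (by rw [← pow_succ, h1])
      rw [e1, inv_pow, e1, inv_inv]
    by_cases hds : d ∣ s
    · apply hsq
      rw [pow_succ, (hdvd s).1 hds] at h1
      rw [sq, h1]
    · have hev : Even d := by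
        by_contra ho
        rw [Nat.not_even_iff_odd] at ho
        exact hds ((Nat.Coprime.dvd_mul_left (Nat.coprime_two_right.2 ho)).1 hd2s)
      obtain ⟨n, hn⟩ := hev
      rw [← two_mul] at hn
      rw [hn] at hd2s hds
      have hns : n ∣ s := Nat.dvd_of_mul_dvd_mul_left two_pos hd2s
      have hn0 : 0 < n := Nat.pos_of_dvd_of_pos hns (by omega)
      have hnM : n ∈ M := by
        refine ⟨hn0, hns, ?_, ?_⟩
        · rw [← Nat.not_even_iff_odd]
          intro he
          apply hds
          obtain ⟨t, ht⟩ := he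
          exact ⟨t, by rw [← Nat.mul_div_cancel' hns, ht]; ring⟩
        · intro i hi1 hi2 hi3 hi4
          apply hi3
          rw [← hn, hdvd]
          exact hfix i (h2 i hi1 hi2 hi4)
      have hmM : m ∈ M := hm ▸ Nat.sSup_mem ⟨n, hnM⟩ hbdd
      have hlM : Nat.lcm m n ∈ M := by
        have hls : Nat.lcm m n ∣ s := Nat.lcm_dvd hmM.2.1 hns
        refine ⟨Nat.lcm_pos hmM.1 hn0, hls, ?_, ?_⟩
        · exact Odd.of_dvd_nat hmM.2.2.1 (Nat.div_dvd_div_left hls (Nat.dvd_lcm_left m n))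
        · intro i hi1 hi2 hi3 hi4
          apply hi3
          rw [← Nat.lcm_mul_left]
          refine Nat.lcm_dvd ?_ ?_
          · by_contra h; exact hmM.2.2.2 i hi1 hi2 h hi4
          · by_contra h; exact hnM.2.2.2 i hi1 hi2 h hi4
      have hle : Nat.lcm m n ≤ m := by
        conv_rhs => rw [hm]
        exact le_csSup hbdd hlM
      have hnm : n ∣ m := by
        have : Nat.lcm m n = m := le_antisymm hle (Nat.le_of_dvd (Nat.lcm_pos hmM.1 hn0) (Nat.dvd_lcm_left m n))
        rw [← this]; exact Nat.dvd_lcm_right m n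
      obtain ⟨t, ht⟩ := hdec m hmM
      have hfm : z ^ p ^ (2 * m) = z := by
        rw [← hdvd, hn]; exact Nat.mul_dvd_mul_left 2 hnm
      rw [ht, pow_succ, per_pow p k z _ hfm] at h1
      rw [pow_succ, h1]
  · intro h
    rcases Set.eq_empty_or_nonempty M with hE | hE
    · rw [hE, csSup_empty, bot_eq_zero] at hm
      rw [hm] at h
      have := hsq (by simpa using h)
      exact ⟨this s, fun i _ _ _ => this _⟩
    · have hmM : m ∈ M := hm ▸ Nat.sSup_mem hE hbdd
      obtain ⟨t, ht⟩ := hdec m hmM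
      have e1 : z ^ p ^ m = z⁻¹ := eq_inv_of_mul_eq_one_left (by rw [← pow_succ, h])
      have hfm : z ^ p ^ (2 * m) = z := by
        rw [two_mul, pow_add, pow_mul, e1, inv_pow, e1, inv_inv]
      have main : ∀ u, z ^ (p ^ (m + 2 * m * u) + 1) = 1 := by
        intro u
        rw [pow_succ, per_pow p k z _ hfm, ← pow_succ, h]
      refine ⟨by rw [ht]; exact main t, ?_⟩
      intro i hi1 hi2 hi3
      have hdi : 2 * m ∣ i := by
        by_contra hc; exact hmM.2.2.2 i hi1 hi2 hc hi3
      obtain ⟨u, hu⟩ := hdi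
      rw [ht, hu, show m + 2 * m * t + 2 * m * u = m + 2 * m * (t + u) by ring]
      exact main _

set_option maxHeartbeats 1000000 in
/-- existence of `g` -/
theorem exists_g [IsAlgClosed k] (hodd : Odd p) (s : ℕ) (hs : 1 ≤ s)
    (hdim : Module.finrank (ZMod p) V = 2 * s)
    (B : LinearMap.BilinForm (ZMod p) V) (hsymm : B.IsSymm)
    (f : k ⊗[ZMod p] V)
    (h0 : ∀ j, j < s → bcForm p k V B f ((frobT p k V)^[j] f) = 0)
    (h1 : bcForm p k V B f ((frobT p k V)^[s] f) = 1)
    (z : k)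
    (hz : ∀ i, i < s → bcForm p k V B f ((frobT p k V)^[s + i] f) ≠ 0 → z ^ (p ^ (s + i) + 1) = 1) :
    ∃ g : V ≃ₗ[ZMod p] V, (∀ x y, B (g x) (g y) = B x y) ∧
      LinearMap.baseChange k (g : V →ₗ[ZMod p] V) f = z • f := by
  have hfin : Module.Finite (ZMod p) V := Module.finite_of_finrank_pos (by omega)
  have hp2 : (2 : k) ≠ 0 := by
    have : NeZero (2 : k) := by
      refine ⟨fun h => ?_⟩
      have h2 : ((2 : ℕ) : k) = 0 := by exact_mod_cast h
      rw [CharP.cast_eq_zero_iff k p] at h2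
      have := (Nat.prime_dvd_prime_iff_eq Fact.out Nat.prime_two).1 h2
      subst this
      exact absurd hodd (by decide)
    exact this.ne
  set b := bcForm p k V B with hb
  set φ := frobT p k V with hφ
  set F : ℕ → k ⊗[ZMod p] V := fun i => φ^[i] f with hF
  have hFs : ∀ i, φ (F i) = F (i + 1) := fun i => (Function.iterate_succ_apply' _ _ _).symm
  have hsy : ∀ x y, b x y = b y x := bc_symm p k V B hsymm
  have hsh : ∀ i j, b (F i) (F (i + j)) = (b f (F j)) ^ p ^ i := by
    intro i j
    simp only [hF, Function.iterate_add_apply]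
    exact bc_frob_iter p k V B i _ _
  have hpi : ∀ i, p ^ i ≠ 0 := fun i => pow_ne_zero _ (Fact.out : p.Prime).ne_zero
  have H0 : ∀ i j, i ≤ j → j < i + s → b (F i) (F j) = 0 := by
    intro i j hij hj
    obtain ⟨t, rfl⟩ := Nat.exists_eq_add_of_le hij
    rw [hsh, h0 t (by omega), zero_pow (hpi i)]
  have H1 : ∀ i, b (F i) (F (i + s)) = 1 := by
    intro i; rw [hsh, h1, one_pow]
  have H0' : ∀ i j, i < j + s → j < i + s → b (F i) (F j) = 0 := by
    intro i j h h'
    rcases le_total i j with hh | hh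
    · exact H0 i j hh h'
    · rw [hsy]; exact H0 j i hh h
  have hz1 : z ^ (p ^ s + 1) = 1 := by
    have := hz 0 (by omega) (by rw [add_zero, h1]; exact one_ne_zero)
    simpa using this
  have hz0 : z ≠ 0 := by
    rintro rfl
    simp at hz1
  have hz2 : z ^ p ^ (2 * s) = z := by
    have e1 : z ^ p ^ s = z⁻¹ := eq_inv_of_mul_eq_one_left (by rw [← pow_succ, hz1])
    rw [two_mul, pow_add, pow_mul, e1, inv_pow, e1, inv_inv]
  have hzF : ∀ i j, i < j + 2 * s → j < i + 2 * s →
      z ^ p ^ i * (z ^ p ^ j * b (F i) (F j)) = b (F i) (F j) := by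
    have aux : ∀ i j, i ≤ j → j < i + 2 * s →
      z ^ p ^ i * (z ^ p ^ j * b (F i) (F j)) = b (F i) (F j) := by
      intro i j hij hj
      by_cases hc : j < i + s
      · rw [H0 i j hij hc]; simp
      · obtain ⟨t, rfl⟩ := Nat.exists_eq_add_of_le (not_lt.1 hc)
        rw [add_assoc, hsh]
        by_cases hb0 : b f (F (s + t)) = 0
        · rw [hb0, zero_pow (hpi i)]; simp
        · have := hz t (by omega) hb0
          rw [← mul_assoc]
          convert one_mul _
          rw [pow_add p i, mul_comm (p ^ i), pow_mul, ← mul_pow, mul_comm, ← pow_succ, this, one_pow]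
    intro i j h h'
    rcases le_total i j with hh | hh
    · exact aux i j hh h'
    · have := aux j i hh h
      rw [hsy (F i) (F j)]
      linear_combination this
  have hli : LinearIndependent k (fun i : Fin (2 * s) => F i) := seq_li k b s F hsy H0 H1
  have hdimk : Module.finrank k (k ⊗[ZMod p] V) = 2 * s := by
    rw [Module.finrank_baseChange, hdim]
  have : Nonempty (Fin (2 * s)) := ⟨⟨0, by omega⟩⟩
  let bs := basisOfLinearIndependentOfCardEqFinrank hli (by rw [hdimk, Fintype.card_fin])
  have hbs : ∀ i, bs i = F i := fun i => by simp [bs]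
  let G : k ⊗[ZMod p] V →ₗ[k] k ⊗[ZMod p] V := bs.constr k (fun i => z ^ p ^ (i : ℕ) • F i)
  have hG : ∀ i, i < 2 * s → G (F i) = z ^ p ^ i • F i := by
    intro i hi
    have := bs.constr_basis k (fun i => z ^ p ^ (i : ℕ) • F i) ⟨i, hi⟩
    rwa [hbs] at this
  have hGb : ∀ x y, b (G x) (G y) = b x y := by
    have : b.compl₁₂ G G = b := by
      refine LinearMap.BilinForm.ext_basis bs fun i j => ?_
      rw [LinearMap.compl₁₂_apply, hbs, hbs, hG _ i.2, hG _ j.2]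
      simp only [map_smul, LinearMap.smul_apply, smul_eq_mul]
      have := hzF i j (by omega) (by omega)
      linear_combination this
    intro x y
    exact congrArg (fun c : LinearMap.BilinForm k (k ⊗[ZMod p] V) => c x y) this
  have hG2 : G (F (2 * s)) = z • F (2 * s) := by
    set D := G (F (2 * s)) - z • F (2 * s) with hD
    have hDorth : ∀ j, 1 ≤ j → j < 2 * s → b D (F j) = 0 := by
      intro j hj1 hj2
      have e1 := hGb (F (2 * s)) (F j)
      rw [hG j hj2, map_smul, smul_eq_mul] at e1
      have e2 := hzF (2 * s) j (by omega) (by omega)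
      rw [hz2] at e2
      have hzj : z ^ p ^ j ≠ 0 := pow_ne_zero _ hz0
      apply mul_left_cancel₀ hzj
      rw [hD, map_sub, map_smul, LinearMap.sub_apply, LinearMap.smul_apply, smul_eq_mul]
      linear_combination e1 - e2
    -- D is a multiple of F s
    have hDeq : D = (b D (F (2 * s))) • F s := by
      rw [← sub_eq_zero]
      refine seq_nondeg k b s hs hdimk (fun i => F (i + 1)) hsy
        (fun i j h h' => H0 _ _ (by omega) (by omega))
        (fun i => by
          have := H1 (i + 1)
          rwa [show i + 1 + s = i + s + 1 by ring] at this) _ ?_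
      intro t ht
      rw [map_sub, map_smul, smul_eq_mul]
      by_cases ht2 : t + 1 = 2 * s
      · rw [ht2, hsy _ (F s), hsy _ D, show b (F s) (F (2 * s)) = 1 by rw [two_mul]; exact H1 s]
        ring
      · rw [hsy _ D, hDorth _ (by omega) (by omega), H0' (t + 1) s (by omega) (by omega)]
        ring
    set c := b D (F (2 * s)) with hc
    have e0 : G (F (2 * s)) = z • F (2 * s) + c • F s := by rw [← hDeq, hD]; abel
    have e1 := hGb (F (2 * s)) (F (2 * s))
    have e2 : b (F s) (F (2 * s)) = 1 := by rw [two_mul]; exact H1 s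
    have e3 : b (F (2 * s)) (F s) = 1 := by rw [hsy, e2]
    rw [e0] at e1
    simp only [map_add, map_smul, LinearMap.add_apply, LinearMap.smul_apply, smul_eq_mul, e2, e3,
      H0 (2 * s) (2 * s) le_rfl (by omega), H0 s s le_rfl (by omega)] at e1
    have hc0 : c = 0 := by
      have : 2 * z * c = 0 := by linear_combination e1
      simpa [hp2, hz0] using this
    rw [e0, hc0, zero_smul, add_zero]
  have hGφ : ∀ x, G (φ x) = φ (G x) := by
    have hb' : ∀ i : Fin (2 * s), G (φ (bs i)) = φ (G (bs i)) := by
      intro i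
      rw [hbs, hG _ i.2, map_smulₛₗ, hFs, frobenius_def, ← pow_mul, ← pow_succ]
      by_cases hi : (i : ℕ) + 1 < 2 * s
      · exact hG _ hi
      · rw [show (i : ℕ) + 1 = 2 * s by omega, hG2, hz2]
    have : (G.comp φ : k ⊗[ZMod p] V →ₛₗ[frobenius k p] k ⊗[ZMod p] V) = φ.comp G :=
      bs.ext hb'
    intro x
    exact congrArg (fun c : k ⊗[ZMod p] V →ₛₗ[frobenius k p] k ⊗[ZMod p] V => c x) this
  have hinj1 : Function.Injective (fun v : V => (1 : k) ⊗ₜ[ZMod p] v) :=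
    Module.FaithfullyFlat.tensorProduct_mk_injective (A := ZMod p) (B := k) V
  have hex : ∀ v : V, ∃ w : V, (1 : k) ⊗ₜ[ZMod p] w = G (1 ⊗ₜ v) := by
    intro v
    apply frobT_fixed
    rw [← hφ, ← hGφ, hφ, frobT_tmul, one_pow]
  choose g0 hg0 using hex
  let g1 : V →ₗ[ZMod p] V :=
    { toFun := g0
      map_add' := fun x y => hinj1 (by simp only [tmul_add, hg0, map_add])
      map_smul' := fun c x => hinj1 (by
        simp only [RingHom.id_apply, tmul_smul, hg0]
        rw [← algebraMap_smul k c, map_smul, algebraMap_smul]) }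
  have hgiso : ∀ x y, B (g1 x) (g1 y) = B x y := by
    intro x y
    have h := hGb (1 ⊗ₜ x) (1 ⊗ₜ y)
    rw [← hg0, ← hg0, hb] at h
    simp only [LinearMap.BilinForm.baseChange_tmul, mul_one, Algebra.smul_def] at h
    exact (algebraMap (ZMod p) k).injective h
  have hGinj : Function.Injective G := by
    rw [LinearMap.injective_iff_surjective, ← LinearMap.range_eq_top, eq_top_iff, ← bs.span_eq,
      Submodule.span_le]
    rintro _ ⟨i, rfl⟩
    refine ⟨(z ^ p ^ (i : ℕ))⁻¹ • F i, ?_⟩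
    rw [map_smul, hG _ i.2, smul_smul, inv_mul_cancel₀ (pow_ne_zero _ hz0), one_smul, hbs]
  have hg1inj : Function.Injective g1 := by
    intro x y hxy
    apply hinj1
    apply hGinj
    change G (1 ⊗ₜ x) = G (1 ⊗ₜ y)
    rw [← hg0, ← hg0]
    exact congrArg _ hxy
  have hbc : LinearMap.baseChange k g1 = G := by
    ext v
    simp [← hg0, g1]
  refine ⟨LinearEquiv.ofInjectiveEndo g1 hg1inj, fun x y => hgiso x y, ?_⟩
  have : ((LinearEquiv.ofInjectiveEndo g1 hg1inj : V ≃ₗ[ZMod p] V) : V →ₗ[ZMod p] V) = g1 := by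
    ext v; simp
  rw [this, hbc]
  have := hG 0 (by omega)
  simpa [hF] using this
end helpers

/-- the image of `O_K(V)` under the eigenvalue character is exactly the
group of `(p^m + 1)`-th roots of unity, where `m` is the largest positive divisor of
`σ₀` such that `σ₀/m` is odd and `a_i = 0` whenever `2m ∤ i` (and `m = 0` if no such
divisor exists; note `sSup ∅ = 0` in `ℕ`). -/
theorem statement7
    (p : ℕ) [Fact p.Prime] (hodd : Odd p)
    (k : Type) [Field k] [CharP k p] [Algebra (ZMod p) k] [IsAlgClosed k]
    (V : Type) [AddCommGroup V] [Module (ZMod p) V]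
    (σ₀ : ℕ) (hσ : 1 ≤ σ₀)
    (hdim : Module.finrank (ZMod p) V = 2 * σ₀)
    (B : LinearMap.BilinForm (ZMod p) V)
    (hsymm : B.IsSymm) (hnd : B.Nondegenerate)
    (hnn : ∀ W : Submodule (ZMod p) V,
      (∀ x ∈ W, ∀ y ∈ W, B x y = 0) → Module.finrank (ZMod p) W ≠ σ₀)
    (K : Submodule k (k ⊗[ZMod p] V))
    (hK : IsStrictlyCharacteristicSub p k V σ₀ B K)
    (e : k ⊗[ZMod p] V)
    (hgen : Submodule.span k {e} = lK p k V σ₀ K)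
    (hnorm : bcForm p k V B e ((⇑(frobT p k V))^[σ₀] e) = 1)
    (m : ℕ)
    (hm : m = sSup {m' : ℕ | 0 < m' ∧ m' ∣ σ₀ ∧ Odd (σ₀ / m') ∧
      ∀ i : ℕ, 1 ≤ i → i ≤ σ₀ - 1 → ¬ (2 * m' ∣ i) →
        bcForm p k V B e ((⇑(frobT p k V))^[σ₀ + i] e) = 0})
    :
    {ζ : k | ∃ g ∈ OK p k V B K,
        LinearMap.baseChange k (g : V →ₗ[ZMod p] V) e = ζ • e}
      = {ζ : k | ζ ^ (p ^ m + 1) = 1} := by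
  have hex : ∀ i, i < σ₀ → ∃ y ∈ K, (frobT p k V)^[i] y = e := by
    intro i hi
    have he : e ∈ lK p k V σ₀ K := hgen ▸ Submodule.mem_span_singleton_self e
    have := (Submodule.mem_iInf _).1 he ⟨i, hi⟩
    exact (mem_iter_map p k V K i e).1 this
  obtain ⟨f, hfK, hfe⟩ := hex (σ₀ - 1) (by omega)
  have hinj : ∀ n, Function.Injective (frobT p k V)^[n] := fun n => (frobT_inj p k V).iterate n
  have hFK : ∀ j, j < σ₀ → (frobT p k V)^[j] f ∈ K := by
    intro j hj
    obtain ⟨y, hy, hye⟩ := hex (σ₀ - 1 - j) (by omega)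
    have : (frobT p k V)^[j] f = y := by
      apply hinj (σ₀ - 1 - j)
      rw [hye, ← Function.iterate_add_apply, ← hfe]
      congr 2
      omega
    rwa [this]
  obtain ⟨⟨hiso, hfr, -⟩, -⟩ := hK
  have hae : ∀ i, bcForm p k V B e ((frobT p k V)^[i] e)
      = (bcForm p k V B f ((frobT p k V)^[i] f)) ^ p ^ (σ₀ - 1) := by
    intro i
    rw [← hfe, ← Function.iterate_add_apply, add_comm, Function.iterate_add_apply, bc_frob_iter]
  have h0 : ∀ j, j < σ₀ → bcForm p k V B f ((frobT p k V)^[j] f) = 0 :=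
    fun j hj => hiso _ hfK _ (hFK j hj)
  have h1 : bcForm p k V B f ((frobT p k V)^[σ₀] f) = 1 := by
    apply pow_p_inj p k (σ₀ - 1)
    rw [← hae, hnorm]
  have hroot := root_iff p k hodd σ₀ hσ
    {i | bcForm p k V B e ((frobT p k V)^[σ₀ + i] e) ≠ 0} m (by
      rw [hm]; simp only [Set.mem_setOf_eq, not_not])
  ext ζ
  rw [Set.mem_setOf_eq, Set.mem_setOf_eq, ← hroot]
  constructor
  · rintro ⟨g, ⟨hg, -⟩, hge⟩
    have key : ∀ i, bcForm p k V B e ((frobT p k V)^[i] e) ≠ 0 → ζ ^ (p ^ i + 1) = 1 := by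
      intro i hi
      have h := bc_isom p k V B (g : V →ₗ[ZMod p] V) hg e ((frobT p k V)^[i] e)
      rw [frobT_iter_baseChange, hge, frob_iter_smul] at h
      simp only [map_smul, LinearMap.smul_apply, smul_eq_mul] at h
      apply mul_right_cancel₀ hi
      rw [pow_succ]
      linear_combination h
    exact ⟨key _ (by rw [hnorm]; exact one_ne_zero), fun i _ _ hi => key _ hi⟩
  · rintro ⟨hz1, hz2⟩
    obtain ⟨η, hη⟩ : ∃ η : k, η ^ p ^ (σ₀ - 1) = ζ := IsAlgClosed.exists_pow_nat_eq ζ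
      (pow_pos (Fact.out : p.Prime).pos _)
    have hηr : ∀ n, ζ ^ (p ^ n + 1) = 1 → η ^ (p ^ n + 1) = 1 := by
      intro n hn
      apply pow_p_inj p k (σ₀ - 1)
      rw [← pow_mul, mul_comm, pow_mul, hη, hn]
    have hz : ∀ i, i < σ₀ → bcForm p k V B f ((frobT p k V)^[σ₀ + i] f) ≠ 0 →
        η ^ (p ^ (σ₀ + i) + 1) = 1 := by
      intro i hi hne
      apply hηr
      rcases Nat.eq_zero_or_pos i with rfl | hpos
      · exact hz1
      · refine hz2 i hpos (by omega) ?_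
        rw [Set.mem_setOf_eq, hae]
        exact pow_ne_zero _ hne
    obtain ⟨g, hg, hgf⟩ := exists_g p k V hodd σ₀ hσ hdim B hsymm f h0 h1 η hz
    have hfin : Module.Finite (ZMod p) V := Module.finite_of_finrank_pos (by omega)
    have hgF : ∀ i, LinearMap.baseChange k (g : V →ₗ[ZMod p] V) ((frobT p k V)^[i] f)
        = η ^ p ^ i • (frobT p k V)^[i] f := by
      intro i
      rw [frobT_iter_baseChange, hgf, frob_iter_smul]
    refine ⟨g, ⟨hg, ?_⟩, ?_⟩
    · have hsh : ∀ i j, bcForm p k V B ((frobT p k V)^[i] f) ((frobT p k V)^[i + j] f)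
          = (bcForm p k V B f ((frobT p k V)^[j] f)) ^ p ^ i := by
        intro i j
        rw [Function.iterate_add_apply]
        exact bc_frob_iter p k V B i _ _
      have hli := seq_li k (bcForm p k V B) σ₀ (fun i => (frobT p k V)^[i] f)
        (bc_symm p k V B hsymm)
        (fun i j hij hj => by
          obtain ⟨t, rfl⟩ := Nat.exists_eq_add_of_le hij
          rw [hsh, h0 t (by omega), zero_pow (pow_ne_zero _ (Fact.out : p.Prime).ne_zero)])
        (fun i => by rw [hsh, h1, one_pow])
      have hli2 := hli.comp (Fin.castLE (by omega : σ₀ ≤ 2 * σ₀)) (Fin.castLE_injective _)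
      have hspan : Submodule.span k (Set.range
          ((fun i : Fin (2 * σ₀) => (frobT p k V)^[(i : ℕ)] f) ∘ Fin.castLE (by omega : σ₀ ≤ 2 * σ₀))) = K := by
        apply Submodule.eq_of_le_of_finrank_eq
        · rw [Submodule.span_le]
          rintro _ ⟨i, rfl⟩
          exact hFK i i.2
        · rw [finrank_span_eq_card hli2, Fintype.card_fin, hfr]
      apply Submodule.eq_of_le_of_finrank_eq
      · conv_lhs => rw [← hspan]
        rw [Submodule.map_span, Submodule.span_le]
        rintro _ ⟨_, ⟨i, rfl⟩, rfl⟩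
        change LinearMap.baseChange k (g : V →ₗ[ZMod p] V) ((frobT p k V)^[(i : ℕ)] f) ∈ K
        rw [hgF]
        exact K.smul_mem _ (hFK i i.2)
      · exact LinearEquiv.finrank_map_eq (LinearEquiv.baseChange (ZMod p) k V V g) K
    · have := hgF (σ₀ - 1)
      rwa [hη, hfe] at this
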